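/- arXiv:2603.12197 — 2 statements merged into one kernel-verified Lean document; each statement's English description precedes it below -/
import Mathlib

section
/- Let d = 2 and let μ be a commutator matrix over ℤ₂. The following are equivalent: (1) there is no non-contextual value assignment l : C(μ) → ℤ₂; (2) there exists a contextual word for μ; (3) there exist pairwise distinct g₁, g₂, g₃, g₄ ∈ C(μ) with g₁ ⊙ g₂, g₁ ⊙ g₃, ¬(g₂ ⊙ g₃), ¬(g₁ ⊙ g₄), and additionally one of: (i) ¬(g₂ ⊙ g₄) and ¬(g₃ ⊙ g₄); (ii) g₃ ⊙ g₄ and ¬(g₂ ⊙ g₄); (iii) g₂ ⊙ g₄ and g₃ ⊙ g₄ (i.e., the graph (C(μ), ⊙) contains one of the three 4-vertex graphs as an induced subgraph). -/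
/-- `Σ𝒮(s)`: the sum over inversions of the word `s`. -/
def invSum (n d : ℕ) (μ : Fin n → Fin n → ZMod d) : List (Fin n) → ZMod d
  | [] => 0
  | x :: s => (s.map (fun y => if y < x then μ x y else 0)).sum + invSum n d μ s

/-- `Σ𝒮(s,t)`: the sum over inversions between `s` and `t`. -/
def invSum2 (n d : ℕ) (μ : Fin n → Fin n → ZMod d) (s t : List (Fin n)) : ZMod d :=
  (s.map (fun x => (t.map (fun y => if y < x then μ x y else 0)).sum)).sum

/-- The formal commutator `⟦s,t⟧ := Σ𝒮(s,t) − Σ𝒮(t,s)`. -/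
def fcomm (n d : ℕ) (μ : Fin n → Fin n → ZMod d) (s t : List (Fin n)) : ZMod d :=
  invSum2 n d μ s t - invSum2 n d μ t s

/-- Bracketings: binary trees with leaves labelled by generators. -/
inductive Brack (n : ℕ) : Type where
  | leaf : Fin n → Brack n
  | node : Brack n → Brack n → Brack n

/-- `∂(β)`: the word of leaf labels of a bracketing. -/
def Brack.word {n : ℕ} : Brack n → List (Fin n)
  | .leaf x => [x]
  | .node b₁ b₂ => b₁.word ++ b₂.word

/-- A bracketing witnesses commuting products if `⟦∂(β₁), ∂(β₂)⟧ = 0` at every internal node. -/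
def Brack.Ok (n d : ℕ) (μ : Fin n → Fin n → ZMod d) : Brack n → Prop
  | .leaf _ => True
  | .node b₁ b₂ =>
      fcomm n d μ b₁.word b₂.word = 0 ∧ Brack.Ok n d μ b₁ ∧ Brack.Ok n d μ b₂

/-- `w` is formed out of commuting products. -/
def Commuting (n d : ℕ) (μ : Fin n → Fin n → ZMod d) (w : List (Fin n)) : Prop :=
  ∃ β : Brack n, Brack.Ok n d μ β ∧ β.word = w

/-- A contextual word for μ. -/
def ContextualWord (n d : ℕ) (μ : Fin n → Fin n → ZMod d) (w : List (Fin n)) : Prop :=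
  w ≠ [] ∧ (∀ x : Fin n, d ∣ w.count x) ∧ Commuting n d μ w ∧ invSum n d μ w ≠ 0

/-- The strictly-lower-triangular pairing `μ̌(k⃗, l⃗) = k⃗ᵀ μ̌ l⃗`. -/
def cPair (n d : ℕ) (μ : Fin n → Fin n → ZMod d) (k l : Fin n → ZMod d) : ZMod d :=
  ∑ i, ∑ j, if j < i then k i * μ i j * l j else 0

/-- The product of the group H(μ). -/
def Hmul (n d : ℕ) (μ : Fin n → Fin n → ZMod d)
    (g h : ZMod d × (Fin n → ZMod d)) : ZMod d × (Fin n → ZMod d) :=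
  (g.1 + h.1 + cPair n d μ g.2 h.2, g.2 + h.2)

/-- C(μ): the smallest subset of H(μ) containing the scalars `(k, 0⃗)` and the
generators `(0, eᵢ)`, closed under products of commuting elements. -/
inductive InC (n d : ℕ) (μ : Fin n → Fin n → ZMod d) : ZMod d × (Fin n → ZMod d) → Prop where
  | scalar (k : ZMod d) : InC n d μ (k, 0)
  | gen (i : Fin n) : InC n d μ (0, Pi.single i 1)
  | mul {g h : ZMod d × (Fin n → ZMod d)} : InC n d μ g → InC n d μ h →
      Hmul n d μ g h = Hmul n d μ h g → InC n d μ (Hmul n d μ g h)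

/-- A non-contextual value assignment on C(μ). -/
def NCVA (n d : ℕ) (μ : Fin n → Fin n → ZMod d)
    (l : ZMod d × (Fin n → ZMod d) → ZMod d) : Prop :=
  (∀ k : ZMod d, l (k, 0) = k) ∧
  ∀ g h : ZMod d × (Fin n → ZMod d), InC n d μ g → InC n d μ h →
    Hmul n d μ g h = Hmul n d μ h g → l (Hmul n d μ g h) = l g + l h

/-- The compatibility (commeasurability) relation ⊙. -/
def Odot (n d : ℕ) (μ : Fin n → Fin n → ZMod d) (g h : ZMod d × (Fin n → ZMod d)) : Prop :=
  Hmul n d μ g h = Hmul n d μ h g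

open Classical in
/-- Over `ZMod 2`, a bilinear form alternating on a subspace is the polar form of some function. -/
theorem exists_polar_on {V : Type*} [AddCommGroup V] [Module (ZMod 2) V] [Finite V]
    (B : V →ₗ[ZMod 2] V →ₗ[ZMod 2] ZMod 2) (A : Submodule (ZMod 2) V)
    (halt : ∀ a ∈ A, B a a = 0) :
    ∃ f : V → ZMod 2, ∀ a ∈ A, ∀ b ∈ A, f (a + b) = f a + f b + B a b := by
  let b := Module.finBasis (ZMod 2) A
  let T : A →ₗ[ZMod 2] A →ₗ[ZMod 2] ZMod 2 :=
    b.constr (ZMod 2) fun i => b.constr (ZMod 2) fun j => if i < j then B (b i) (b j) else 0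
  have hsymm : ∀ x y : A, B x y = B y x := by
    intro x y
    have h := halt _ (x + y).2
    have hx := halt _ x.2
    have hy := halt _ y.2
    simp only [Submodule.coe_add, map_add, LinearMap.add_apply, hx, hy] at h
    rw [zero_add, add_zero] at h
    exact (CharTwo.add_eq_zero.mp h).symm
  have hT : T + T.flip = (B.domRestrict₁₂ A A) := by
    refine b.ext fun i => b.ext fun j => ?_
    have h1 : T (b i) (b j) = if i < j then B (b i) (b j) else 0 := by
      rw [Module.Basis.constr_basis, Module.Basis.constr_basis]
    have h2 : T (b j) (b i) = if j < i then B (b j) (b i) else 0 := by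
      rw [Module.Basis.constr_basis, Module.Basis.constr_basis]
    simp only [LinearMap.add_apply, LinearMap.flip_apply, LinearMap.domRestrict₁₂_apply, h1, h2]
    rcases lt_trichotomy i j with h | h | h
    · simp [h, h.not_gt]
    · subst h
      simp [halt _ (b i).2]
    · simp [h, h.not_gt, hsymm (b i) (b j)]
  refine ⟨fun v => if h : v ∈ A then T ⟨v, h⟩ ⟨v, h⟩ else 0, fun x hx y hy => ?_⟩
  have h := congrArg (fun S => S ⟨x, hx⟩ ⟨y, hy⟩) hT
  simp only [LinearMap.add_apply, LinearMap.flip_apply, LinearMap.domRestrict₁₂_apply] at h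
  have hsum : (⟨x + y, A.add_mem hx hy⟩ : A) = ⟨x, hx⟩ + ⟨y, hy⟩ := rfl
  simp only [hx, hy, A.add_mem hx hy, dite_true, hsum, map_add, LinearMap.add_apply, ← h]
  ring

/-- A function with prescribed polar form on a subspace extends to a larger subspace. -/
theorem exists_polar_extend {V : Type*} [AddCommGroup V] [Module (ZMod 2) V] [Finite V]
    (B : V →ₗ[ZMod 2] V →ₗ[ZMod 2] ZMod 2) (Z A : Submodule (ZMod 2) V) (hZA : Z ≤ A)
    (halt : ∀ a ∈ A, B a a = 0) (f₀ : V → ZMod 2)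
    (hf₀ : ∀ a ∈ Z, ∀ b ∈ Z, f₀ (a + b) = f₀ a + f₀ b + B a b) :
    ∃ f : V → ZMod 2, (∀ a ∈ A, ∀ b ∈ A, f (a + b) = f a + f b + B a b) ∧
      ∀ z ∈ Z, f z = f₀ z := by
  obtain ⟨f, hf⟩ := exists_polar_on B A halt
  let d : Z →+ ZMod 2 := AddMonoidHom.mk' (fun z => f₀ z - f z) fun x y => by
    simp only [Submodule.coe_add, hf₀ _ x.2 _ y.2, hf _ (hZA x.2) _ (hZA y.2)]
    ring
  obtain ⟨g, hg⟩ := LinearMap.exists_extend (d.toZModLinearMap 2)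
  refine ⟨fun v => f v + g v, fun a ha b hb => ?_, fun z hz => ?_⟩
  · simp only [hf a ha b hb, map_add]
    ring
  · have h : g z = f₀ z - f z := congrArg (fun S => S ⟨z, hz⟩) hg
    simp only [h]
    ring

section
variable {n : ℕ} (μ : Fin n → Fin n → ZMod 2)

/-- The pairing `cPair` as a bilinear map. -/
def cForm : (Fin n → ZMod 2) →ₗ[ZMod 2] (Fin n → ZMod 2) →ₗ[ZMod 2] ZMod 2 :=
  LinearMap.mk₂ (ZMod 2) (cPair n 2 μ)
    (fun a b c => by
      simp only [cPair, ← Finset.sum_add_distrib]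
      refine Finset.sum_congr rfl fun i _ => Finset.sum_congr rfl fun j _ => ?_
      split_ifs <;> simp [add_mul])
    (fun r a b => by
      simp only [cPair, smul_eq_mul, Finset.mul_sum]
      refine Finset.sum_congr rfl fun i _ => Finset.sum_congr rfl fun j _ => ?_
      split_ifs <;> simp [mul_assoc])
    (fun a b c => by
      simp only [cPair, ← Finset.sum_add_distrib]
      refine Finset.sum_congr rfl fun i _ => Finset.sum_congr rfl fun j _ => ?_
      split_ifs <;> simp [mul_add])
    (fun r a b => by
      simp only [cPair, smul_eq_mul, Finset.mul_sum]
      refine Finset.sum_congr rfl fun i _ => Finset.sum_congr rfl fun j _ => ?_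
      split_ifs
      · simp only [Pi.smul_apply, smul_eq_mul]
        ring
      · simp)

theorem cPair_eq_cForm (a b : Fin n → ZMod 2) : cPair n 2 μ a b = cForm μ a b := rfl

theorem cForm_single (x y : Fin n) :
    cForm μ (Pi.single x 1) (Pi.single y 1) = if y < x then μ x y else 0 := by
  rw [← cPair_eq_cForm, cPair, Finset.sum_eq_single x, Finset.sum_eq_single y]
  · simp
  · intro j _ hj
    simp [hj]
  · simp
  · intro i _ hi
    simp [hi]
  · simp

/-- The commutator pairing of `H(μ)`. -/
def omega : (Fin n → ZMod 2) →ₗ[ZMod 2] (Fin n → ZMod 2) →ₗ[ZMod 2] ZMod 2 :=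
  cForm μ + (cForm μ).flip

theorem omega_apply (a b : Fin n → ZMod 2) : omega μ a b = cForm μ a b + cForm μ b a := rfl

theorem omega_comm (a b : Fin n → ZMod 2) : omega μ a b = omega μ b a := by
  rw [omega_apply, omega_apply, add_comm]

theorem omega_self (a : Fin n → ZMod 2) : omega μ a a = 0 := CharTwo.add_self_eq_zero _

theorem odot_iff (g h : ZMod 2 × (Fin n → ZMod 2)) : Odot n 2 μ g h ↔ omega μ g.2 h.2 = 0 := by
  rw [Odot, Hmul, Hmul, Prod.mk.injEq, omega_apply, CharTwo.add_eq_zero, cPair_eq_cForm,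
    cPair_eq_cForm, add_comm h.1, add_comm h.2]
  simp

/-- The vector parts of the elements of `C(μ)`. -/
def InCVec (v : Fin n → ZMod 2) : Prop := InC n 2 μ (0, v)

variable {μ}

theorem InC.shift {g : ZMod 2 × (Fin n → ZMod 2)} (hg : InC n 2 μ g) (k : ZMod 2) :
    InC n 2 μ (k, g.2) := by
  have h := InC.mul (InC.scalar (μ := μ) (k - g.1)) hg ((odot_iff μ _ _).2 (by simp))
  simpa [Hmul, cPair_eq_cForm] using h

theorem inC_iff (g : ZMod 2 × (Fin n → ZMod 2)) : InC n 2 μ g ↔ InCVec μ g.2 :=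
  ⟨fun h => h.shift 0, fun h => InC.shift h g.1⟩

theorem InCVec.add {a b : Fin n → ZMod 2} (ha : InCVec μ a) (hb : InCVec μ b)
    (h : omega μ a b = 0) : InCVec μ (a + b) :=
  (inC_iff _).1 (InC.mul ha hb ((odot_iff μ _ _).2 h))

theorem InC.cForm_self {g : ZMod 2 × (Fin n → ZMod 2)} (hg : InC n 2 μ g) :
    cForm μ g.2 g.2 = 0 := by
  induction hg with
  | scalar k => simp
  | gen i => simp [cForm_single]
  | @mul g h _ _ hgh ihg ihh =>
    have hc := (odot_iff μ g h).1 hgh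
    rw [omega_apply] at hc
    simp only [Hmul, map_add, LinearMap.add_apply, ihg, ihh]
    linear_combination hc

/-- The exponent vector of a word modulo `2`. -/
def wordVec (w : List (Fin n)) : Fin n → ZMod 2 := (w.map fun x => Pi.single x 1).sum

@[simp] theorem wordVec_nil : wordVec ([] : List (Fin n)) = 0 := rfl

@[simp] theorem wordVec_cons (x : Fin n) (w : List (Fin n)) :
    wordVec (x :: w) = Pi.single x 1 + wordVec w := rfl

@[simp] theorem wordVec_append (s t : List (Fin n)) :
    wordVec (s ++ t) = wordVec s + wordVec t := by
  simp [wordVec]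

theorem wordVec_apply (w : List (Fin n)) (i : Fin n) : wordVec w i = (w.count i : ZMod 2) := by
  induction w with
  | nil => rfl
  | cons x w ih =>
    rw [wordVec_cons, Pi.add_apply, ih, List.count_cons, Pi.single_apply]
    by_cases h : x = i
    · simp [h, add_comm]
    · simp [h, Ne.symm h]

theorem wordVec_eq_zero_iff (w : List (Fin n)) : wordVec w = 0 ↔ ∀ x, 2 ∣ w.count x := by
  simp [funext_iff, wordVec_apply, ZMod.natCast_eq_zero_iff]

theorem invSum2_eq (s t : List (Fin n)) :
    invSum2 n 2 μ s t = cForm μ (wordVec s) (wordVec t) := by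
  have hx : ∀ x : Fin n, (t.map fun y => if y < x then μ x y else 0).sum =
      cForm μ (Pi.single x 1) (wordVec t) := by
    intro x
    induction t with
    | nil => simp
    | cons y t ih => simp [ih, cForm_single]
  simp only [invSum2, hx]
  induction s with
  | nil => simp
  | cons x s ih => simp [ih]

theorem fcomm_eq (s t : List (Fin n)) :
    fcomm n 2 μ s t = omega μ (wordVec s) (wordVec t) := by
  rw [fcomm, invSum2_eq, invSum2_eq, omega_apply, CharTwo.sub_eq_add]

theorem invSum_append (s t : List (Fin n)) :
    invSum n 2 μ (s ++ t) =
      invSum n 2 μ s + invSum n 2 μ t + cForm μ (wordVec s) (wordVec t) := by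
  rw [← invSum2_eq]
  induction s with
  | nil => simp [invSum, invSum2]
  | cons x s ih =>
    simp only [List.cons_append, invSum, ih, List.map_append, List.sum_append, invSum2,
      List.map_cons, List.sum_cons]
    ring

theorem Hmul_word (s t : List (Fin n)) :
    Hmul n 2 μ (invSum n 2 μ s, wordVec s) (invSum n 2 μ t, wordVec t) =
      (invSum n 2 μ (s ++ t), wordVec (s ++ t)) := by
  rw [invSum_append, wordVec_append]
  rfl

theorem Brack.Ok.inC {b : Brack n} (hb : b.Ok n 2 μ) :
    InC n 2 μ (invSum n 2 μ b.word, wordVec b.word) := by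
  induction b with
  | leaf x => simpa [Brack.word, invSum] using InC.gen (μ := μ) x
  | node b₁ b₂ ih₁ ih₂ =>
    obtain ⟨hc, h₁, h₂⟩ := hb
    rw [fcomm_eq] at hc
    have h := InC.mul (ih₁ h₁) (ih₂ h₂) ((odot_iff μ _ _).2 hc)
    rwa [Hmul_word] at h

theorem Brack.word_ne_nil (b : Brack n) : b.word ≠ [] := by
  induction b with
  | leaf x => simp [Brack.word]
  | node b₁ b₂ ih₁ ih₂ => simp [Brack.word, ih₁]

theorem Brack.Ok.node {b₁ b₂ : Brack n} (h₁ : b₁.Ok n 2 μ) (h₂ : b₂.Ok n 2 μ)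
    (h : omega μ (wordVec b₁.word) (wordVec b₂.word) = 0) : (b₁.node b₂).Ok n 2 μ :=
  ⟨by rwa [fcomm_eq], h₁, h₂⟩

/-- Elements of `C(μ)` with nonzero vector part come from bracketings. -/
theorem InC.exists_brack {g : ZMod 2 × (Fin n → ZMod 2)} (hg : InC n 2 μ g) :
    g.2 = 0 ∨ ∃ b : Brack n, b.Ok n 2 μ ∧ wordVec b.word = g.2 := by
  induction hg with
  | scalar k => exact Or.inl rfl
  | gen i => exact Or.inr ⟨.leaf i, trivial, by simp [Brack.word]⟩
  | @mul g h _ _ hgh ihg ihh =>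
    have hc := (odot_iff μ g h).1 hgh
    rcases ihg with hg0 | ⟨b₁, h₁, e₁⟩
    · simpa [Hmul, hg0] using ihh
    rcases ihh with hh0 | ⟨b₂, h₂, e₂⟩
    · exact Or.inr ⟨b₁, h₁, by simp [Hmul, hh0, e₁]⟩
    · exact Or.inr ⟨b₁.node b₂, h₁.node h₂ (by rwa [e₁, e₂]), by simp [Hmul, Brack.word, e₁, e₂]⟩

theorem NCVA.apply_word {l : ZMod 2 × (Fin n → ZMod 2) → ZMod 2} (hl : NCVA n 2 μ l)
    {b : Brack n} (hb : b.Ok n 2 μ) :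
    l (invSum n 2 μ b.word, wordVec b.word) =
      ∑ x, wordVec b.word x * l (0, Pi.single x 1) := by
  induction b with
  | leaf x => simp [Brack.word, invSum, Pi.single_apply]
  | node b₁ b₂ ih₁ ih₂ =>
    obtain ⟨hc, h₁, h₂⟩ := hb
    rw [fcomm_eq] at hc
    rw [Brack.word, ← Hmul_word, hl.2 _ _ h₁.inC h₂.inC ((odot_iff μ _ _).2 hc), ih₁ h₁, ih₂ h₂,
      wordVec_append, ← Finset.sum_add_distrib]
    simp [add_mul]

theorem not_NCVA_of_contextualWord {w : List (Fin n)} (hw : ContextualWord n 2 μ w)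
    {l : ZMod 2 × (Fin n → ZMod 2) → ZMod 2} (hl : NCVA n 2 μ l) : False := by
  obtain ⟨-, hcount, ⟨b, hb, rfl⟩, hinv⟩ := hw
  have h := hl.apply_word hb
  rw [(wordVec_eq_zero_iff _).2 hcount, hl.1] at h
  exact hinv (by simpa using h)

/-- The word of a Mermin square is contextual. -/
theorem exists_contextualWord_of_square {a b c d : Fin n → ZMod 2} (ha : InCVec μ a)
    (hb : InCVec μ b) (hc : InCVec μ c) (hd : InCVec μ d) (hab : omega μ a b = 0)
    (hac : omega μ a c = 0) (hbd : omega μ b d = 0) (hcd : omega μ c d = 0)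
    (hbc : omega μ b c = 1) (had : omega μ a d = 1) :
    ∃ w : List (Fin n), ContextualWord n 2 μ w := by
  have key : ∀ {u v : Fin n → ZMod 2}, InCVec μ u → omega μ u v = 1 →
      ∃ B : Brack n, B.Ok n 2 μ ∧ wordVec B.word = u := by
    intro u v hu huv
    rcases hu.exists_brack with h | h
    · change u = 0 at h
      simp [h] at huv
    · exact h
  have hcb := hbc
  have hda := had
  rw [omega_comm] at hcb hda
  obtain ⟨A, hA, rfl⟩ := key ha had
  obtain ⟨B, hB, rfl⟩ := key hb hbc
  obtain ⟨C, hC, rfl⟩ := key hc hcb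
  obtain ⟨D, hD, rfl⟩ := key hd hda
  have h2 : (1 + 1 : ZMod 2) = 0 := rfl
  have hleft : ((A.node B).node (C.node D)).Ok n 2 μ :=
    (hA.node hB hab).node (hC.node hD hcd) (by simp [Brack.word, *])
  have hright : ((A.node C).node (B.node D)).Ok n 2 μ :=
    (hA.node hC hac).node (hB.node hD hbd) (by simp [Brack.word, *])
  have hperm : wordVec ((A.node C).node (B.node D)).word =
      wordVec ((A.node B).node (C.node D)).word := by
    simp only [Brack.word, wordVec_append]
    abel
  refine ⟨_, Brack.word_ne_nil _, ?_, ⟨_, hleft.node hright ?_, rfl⟩, ?_⟩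
  · rw [← wordVec_eq_zero_iff, Brack.word, wordVec_append, hperm]
    ext i
    exact CharTwo.add_self_eq_zero _
  · rw [hperm, omega_self]
  · rw [Brack.word, invSum_append, hperm, hleft.inC.cForm_self]
    have h1 : invSum n 2 μ ((A.node B).node (C.node D)).word +
        invSum n 2 μ ((A.node C).node (B.node D)).word =
          omega μ (wordVec B.word) (wordVec C.word) := by
      simp only [Brack.word, invSum_append, wordVec_append, map_add, LinearMap.add_apply,
        omega_apply]
      have h0 : (2 : ZMod 2) = 0 := rfl
      generalize invSum n 2 μ A.word = i₁
      generalize invSum n 2 μ B.word = i₂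
      generalize invSum n 2 μ C.word = i₃
      generalize invSum n 2 μ D.word = i₄
      linear_combination (i₁ + i₂ + i₃ + i₄ + cForm μ (wordVec A.word) (wordVec B.word) +
        cForm μ (wordVec A.word) (wordVec C.word) + cForm μ (wordVec A.word) (wordVec D.word) +
        cForm μ (wordVec B.word) (wordVec D.word) + cForm μ (wordVec C.word) (wordVec D.word)) * h0
    rw [h1, hbc]
    decide

/-- A noncentral element commuting with two elements that do not commute with each other yields a
contextual word. -/
theorem exists_contextualWord_of_not_trans {a b c d : Fin n → ZMod 2} (ha : InCVec μ a)
    (hb : InCVec μ b) (hc : InCVec μ c) (hd : InCVec μ d) (hab : omega μ a b = 0)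
    (hac : omega μ a c = 0) (hbc : omega μ b c ≠ 0) (had : omega μ a d ≠ 0) :
    ∃ w : List (Fin n), ContextualWord n 2 μ w := by
  have hone : ∀ x : ZMod 2, x ≠ 0 → x = 1 := by decide
  have h2 : (1 + 1 : ZMod 2) = 0 := rfl
  replace hbc := hone _ hbc
  replace had := hone _ had
  have key : ∀ {u : Fin n → ZMod 2}, InCVec μ u → omega μ a u = 0 → ∃ u' : Fin n → ZMod 2,
      InCVec μ u' ∧ omega μ a u' = 0 ∧ omega μ u' d = 0 ∧ ∀ v, omega μ a v = 0 →
        omega μ u' v = omega μ u v := by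
    intro u hu hau
    by_cases h : omega μ u d = 0
    · exact ⟨u, hu, hau, h, fun _ _ => rfl⟩
    · refine ⟨a + u, ha.add hu hau, ?_, ?_, fun v hv => ?_⟩
      · simp [omega_self, hau]
      · simp [had, hone _ h, h2]
      · simp [hv]
  obtain ⟨b', hb', hab', hbd', hbv⟩ := key hb hab
  obtain ⟨c', hc', hac', hcd', hcv⟩ := key hc hac
  refine exists_contextualWord_of_square ha hb' hc' hd hab' hac' hbd' hcd' ?_ had
  rw [hbv _ hac', omega_comm, hcv _ hab, omega_comm, hbc]

open Classical in
/-- If commutation is transitive on noncentral elements, there is a value assignment. -/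
theorem exists_NCVA_of_trans
    (htrans : ∀ a b c d : Fin n → ZMod 2, InCVec μ a → InCVec μ b → InCVec μ c → InCVec μ d →
      omega μ a b = 0 → omega μ a c = 0 → omega μ a d ≠ 0 → omega μ b c = 0) :
    ∃ l : ZMod 2 × (Fin n → ZMod 2) → ZMod 2, NCVA n 2 μ l := by
  have hsmul : ∀ (S : Set (Fin n → ZMod 2)), 0 ∈ S → ∀ (r : ZMod 2) {x}, x ∈ S → r • x ∈ S := by
    intro S h0 r x hx
    obtain rfl | rfl : r = 0 ∨ r = 1 := by revert r; decide
    · simpa using h0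
    · simpa using hx
  have hzero : InCVec μ 0 := InC.scalar 0
  let C₀ : Set (Fin n → ZMod 2) := {z | InCVec μ z ∧ ∀ u, InCVec μ u → omega μ z u = 0}
  let Z : Submodule (ZMod 2) (Fin n → ZMod 2) :=
    { carrier := C₀
      zero_mem' := ⟨hzero, by simp⟩
      add_mem' := fun {x y} hx hy => ⟨hx.1.add hy.1 (hx.2 y hy.1), fun u hu => by
        simp [hx.2 u hu, hy.2 u hu]⟩
      smul_mem' := fun r _ hx => hsmul C₀ ⟨hzero, by simp⟩ r hx }
  let S : (Fin n → ZMod 2) → Set (Fin n → ZMod 2) := fun v => {a | InCVec μ a ∧ omega μ v a = 0}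
  have hnc : ∀ v, InCVec μ v → v ∉ Z → ∃ u, InCVec μ u ∧ omega μ v u ≠ 0 := by
    intro v hv hvZ
    by_contra! h
    exact hvZ ⟨hv, h⟩
  have hSub : ∀ v, InCVec μ v → v ∉ Z →
      ∃ A : Submodule (ZMod 2) (Fin n → ZMod 2), (A : Set _) = S v := by
    intro v hv hvZ
    obtain ⟨u, hu, huv⟩ := hnc v hv hvZ
    exact ⟨{ carrier := S v
             zero_mem' := ⟨hzero, by simp⟩
             add_mem' := fun {x y} hx hy => ⟨hx.1.add hy.1
               (htrans v x y u hv hx.1 hy.1 hu hx.2 hy.2 huv), by simp [hx.2, hy.2]⟩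
             smul_mem' := fun r _ hx => hsmul (S v) ⟨hzero, by simp⟩ r hx }, rfl⟩
  obtain ⟨f₀, hf₀⟩ := exists_polar_on (cForm μ) Z fun z hz => hz.1.cForm_self
  have hext : ∀ T : Set (Fin n → ZMod 2), ∃ f : (Fin n → ZMod 2) → ZMod 2,
      ∀ v, InCVec μ v → v ∉ Z → T = S v →
        (∀ a ∈ T, ∀ b ∈ T, f (a + b) = f a + f b + cForm μ a b) ∧ ∀ z ∈ Z, f z = f₀ z := by
    intro T
    by_cases hT : ∃ v, InCVec μ v ∧ v ∉ Z ∧ T = S v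
    · obtain ⟨v, hv, hvZ, rfl⟩ := hT
      obtain ⟨A, hA⟩ := hSub v hv hvZ
      have hmem : ∀ x, x ∈ A ↔ x ∈ S v := fun x => by rw [← hA]; rfl
      obtain ⟨f, hf, hfZ⟩ := exists_polar_extend (cForm μ) Z A
        (fun z hz => (hmem z).2 ⟨hz.1, by rw [omega_comm]; exact hz.2 v hv⟩)
        (fun a ha => ((hmem a).1 ha).1.cForm_self) f₀ hf₀
      refine ⟨f, fun _ _ _ _ => ⟨fun a ha b hb => ?_, hfZ⟩⟩
      exact hf a ((hmem a).2 ha) b ((hmem b).2 hb)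
    · exact ⟨0, fun v hv hvZ h => (hT ⟨v, hv, hvZ, h⟩).elim⟩
  choose f hf using hext
  let F : (Fin n → ZMod 2) → ZMod 2 := fun v => if v ∈ Z then f₀ v else f (S v) v
  have hFZ : ∀ z ∈ Z, F z = f₀ z := fun z hz => if_pos hz
  have hFS : ∀ v, InCVec μ v → v ∉ Z → ∀ a ∈ S v, F a = f (S v) a := by
    intro v hv hvZ a ha
    by_cases haZ : a ∈ Z
    · rw [hFZ a haZ, (hf (S v) v hv hvZ rfl).2 a haZ]
    · have hSS : S a = S v := by
        obtain ⟨u, hu, huv⟩ := hnc v hv hvZ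
        obtain ⟨t, ht, hta⟩ := hnc a ha.1 haZ
        ext x
        constructor
        · intro hx
          exact ⟨hx.1, htrans a v x t ha.1 hv hx.1 ht (by rw [omega_comm]; exact ha.2) hx.2 hta⟩
        · intro hx
          exact ⟨hx.1, htrans v a x u hv ha.1 hx.1 hu ha.2 hx.2 huv⟩
      simp only [F, if_neg haZ, hSS]
  have hF : ∀ v, InCVec μ v → v ∉ Z → ∀ a ∈ S v, ∀ b ∈ S v,
      F (a + b) = F a + F b + cForm μ a b := by
    intro v hv hvZ a ha b hb
    obtain ⟨A, hA⟩ := hSub v hv hvZ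
    have hab : a + b ∈ S v := by
      rw [← hA] at ha hb ⊢
      exact A.add_mem ha hb
    rw [hFS v hv hvZ a ha, hFS v hv hvZ b hb, hFS v hv hvZ _ hab]
    exact (hf (S v) v hv hvZ rfl).1 a ha b hb
  have hadd : ∀ a b, InCVec μ a → InCVec μ b → omega μ a b = 0 →
      F (a + b) = F a + F b + cForm μ a b := by
    intro a b ha hb hab
    by_cases haZ : a ∈ Z
    · by_cases hbZ : b ∈ Z
      · rw [hFZ a haZ, hFZ b hbZ, hFZ _ (Z.add_mem haZ hbZ), hf₀ a haZ b hbZ]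
      · exact hF b hb hbZ a ⟨ha, by rwa [omega_comm]⟩ b ⟨hb, omega_self μ b⟩
    · exact hF a ha haZ a ⟨ha, omega_self μ a⟩ b ⟨hb, hab⟩
  have hF0 : F 0 = 0 := by
    have h := hadd 0 0 hzero hzero (by simp)
    simpa using h
  refine ⟨fun g => g.1 + F g.2, fun k => by simp [hF0], fun g h hg hh hgh => ?_⟩
  simp only [Hmul, cPair_eq_cForm,
    hadd g.2 h.2 ((inC_iff g).1 hg) ((inC_iff h).1 hh) ((odot_iff μ g h).1 hgh)]
  linear_combination CharTwo.add_self_eq_zero (cForm μ g.2 h.2)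

end

theorem stmt15 (n : ℕ) (hn : 1 ≤ n) (μ : Fin n → Fin n → ZMod 2)
    (hsymm : ∀ i j, μ i j = μ j i) (hdiag : ∀ i, μ i i = 0) :
    -- (1) ↔ (2)
    ((¬ ∃ l : ZMod 2 × (Fin n → ZMod 2) → ZMod 2, NCVA n 2 μ l) ↔
      (∃ w : List (Fin n), ContextualWord n 2 μ w)) ∧
    -- (2) ↔ (3)
    ((∃ w : List (Fin n), ContextualWord n 2 μ w) ↔
      (∃ g₁ g₂ g₃ g₄ : ZMod 2 × (Fin n → ZMod 2),
        InC n 2 μ g₁ ∧ InC n 2 μ g₂ ∧ InC n 2 μ g₃ ∧ InC n 2 μ g₄ ∧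
        g₁ ≠ g₂ ∧ g₁ ≠ g₃ ∧ g₁ ≠ g₄ ∧ g₂ ≠ g₃ ∧ g₂ ≠ g₄ ∧ g₃ ≠ g₄ ∧
        Odot n 2 μ g₁ g₂ ∧ Odot n 2 μ g₁ g₃ ∧
        ¬ Odot n 2 μ g₂ g₃ ∧ ¬ Odot n 2 μ g₁ g₄ ∧
        ((¬ Odot n 2 μ g₂ g₄ ∧ ¬ Odot n 2 μ g₃ g₄) ∨
         (Odot n 2 μ g₃ g₄ ∧ ¬ Odot n 2 μ g₂ g₄) ∨
         (Odot n 2 μ g₂ g₄ ∧ Odot n 2 μ g₃ g₄)))) := by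
  have h21 : (∃ w : List (Fin n), ContextualWord n 2 μ w) →
      ¬ ∃ l : ZMod 2 × (Fin n → ZMod 2) → ZMod 2, NCVA n 2 μ l :=
    fun ⟨_, hw⟩ ⟨_, hl⟩ => not_NCVA_of_contextualWord hw hl
  have h12 : (¬ ∃ l : ZMod 2 × (Fin n → ZMod 2) → ZMod 2, NCVA n 2 μ l) →
      ∃ w : List (Fin n), ContextualWord n 2 μ w := by
    intro h
    by_contra hw
    exact h (exists_NCVA_of_trans fun a b c d ha hb hc hd hab hac had => by
      by_contra hbc
      exact hw (exists_contextualWord_of_not_trans ha hb hc hd hab hac hbc had))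
  refine ⟨⟨h12, h21⟩, fun hw => ?_, ?_⟩
  · by_contra hno
    refine h21 hw (exists_NCVA_of_trans fun a b c d ha hb hc hd hab hac had => ?_)
    by_contra hbc
    have hba : omega μ b a = 0 := by rw [omega_comm, hab]
    have hca : omega μ c a = 0 := by rw [omega_comm, hac]
    have hcb : omega μ c b ≠ 0 := by rwa [omega_comm]
    have hne : ∀ x y z : Fin n → ZMod 2, omega μ x z = 0 → omega μ y z ≠ 0 →
        ((0 : ZMod 2), x) ≠ (0, y) := by
      rintro x y z hx hy h
      rw [Prod.mk.injEq] at h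
      exact hy (h.2 ▸ hx)
    have hab' := hne a b c hac hbc
    have hac' := hne a c b hab hcb
    have had' := hne a d a (omega_self μ a) (by rwa [omega_comm])
    have hbc' := hne b c b (omega_self μ b) hcb
    have hbd' := hne b d a hba (by rwa [omega_comm])
    have hcd' := hne c d a hca (by rwa [omega_comm])
    simp only [odot_iff] at hno
    by_cases hbd : omega μ b d = 0
    · by_cases hcd : omega μ c d = 0
      · exact hno ⟨(0, a), (0, b), (0, c), (0, d), ha, hb, hc, hd, hab', hac', had', hbc', hbd',
          hcd', hab, hac, hbc, had, Or.inr (Or.inr ⟨hbd, hcd⟩)⟩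
      · exact hno ⟨(0, a), (0, c), (0, b), (0, d), ha, hc, hb, hd, hac', hab', had', hbc'.symm,
          hcd', hbd', hac, hab, hcb, had, Or.inr (Or.inl ⟨hbd, hcd⟩)⟩
    · refine hno ⟨(0, a), (0, b), (0, c), (0, d), ha, hb, hc, hd, hab', hac', had', hbc', hbd',
        hcd', hab, hac, hbc, had, ?_⟩
      by_cases hcd : omega μ c d = 0
      · exact Or.inr (Or.inl ⟨hcd, hbd⟩)
      · exact Or.inl ⟨hbd, hcd⟩
  · rintro ⟨g₁, g₂, g₃, g₄, h₁, h₂, h₃, h₄, -, -, -, -, -, -, h12, h13, h23, h14, -⟩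
    simp only [odot_iff, inC_iff] at *
    exact exists_contextualWord_of_not_trans h₁ h₂ h₃ h₄ h12 h13 h23 h14
end

section
/- For each (k, k⃗) ∈ H(μ), the map ρ(k, k⃗) is a well-defined unitary operator on ℋ; moreover ρ : H(μ) → U(ℋ) is an injective group homomorphism, and it preserves scalars: ρ(k, 0⃗) = ω^k · id for every k ∈ ℤ_d. -/
open scoped ComplexConjugate

/-- ω = e^{2πi/d}, the primitive d-th root of unity. -/
noncomputable def omegad (d : ℕ) : ℂ := Complex.exp (2 * Real.pi * Complex.I / d)

/-- The representation ρ, acting on ℋ = (ℤ_dⁿ → ℂ):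
`ρ(k, k⃗)|l⃗⟩ = ω^{k + μ̌(k⃗, l⃗)}|l⃗ + k⃗⟩`, i.e. `(ρ(k,k⃗) f)(m⃗) = ω^{k + μ̌(k⃗, m⃗−k⃗)} f(m⃗−k⃗)`.
The exponent `ω^a` for `a : ZMod d` is evaluated via the canonical representative
`a.val`, which is well-defined since `ω^d = 1`. -/
noncomputable def rhoF (n d : ℕ) (μ : Fin n → Fin n → ZMod d)
    (g : ZMod d × (Fin n → ZMod d)) (f : (Fin n → ZMod d) → ℂ) :
    (Fin n → ZMod d) → ℂ :=
  fun m => omegad d ^ ((g.1 + cPair n d μ g.2 (m - g.2)).val) * f (m - g.2)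

theorem isPrimitiveRoot_omegad (d : ℕ) [NeZero d] : IsPrimitiveRoot (omegad d) d :=
  Complex.isPrimitiveRoot_exp d (NeZero.ne d)

theorem omegad_pow_ne_zero (d k : ℕ) : omegad d ^ k ≠ 0 :=
  pow_ne_zero _ (Complex.exp_ne_zero _)

theorem omegad_pow_val_add (d : ℕ) [NeZero d] (a b : ZMod d) :
    omegad d ^ (a + b).val = omegad d ^ a.val * omegad d ^ b.val := by
  rw [ZMod.val_add, ← pow_add]
  exact (pow_eq_pow_mod _ (isPrimitiveRoot_omegad d).pow_eq_one).symm

theorem omegad_pow_val_injective (d : ℕ) [NeZero d] :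
    Function.Injective fun a : ZMod d => omegad d ^ a.val := fun a b h =>
  ZMod.val_injective d
    ((isPrimitiveRoot_omegad d).pow_inj (ZMod.val_lt a) (ZMod.val_lt b) h)

theorem conj_omegad_pow_mul_self (d : ℕ) [NeZero d] (k : ℕ) :
    conj (omegad d ^ k) * omegad d ^ k = 1 := by
  rw [Complex.conj_mul', norm_pow,
    (isPrimitiveRoot_omegad d).norm'_eq_one (NeZero.ne d)]
  simp

section cPair

variable {n d : ℕ} (μ : Fin n → Fin n → ZMod d)

theorem cPair_add_left (k k' l : Fin n → ZMod d) :
    cPair n d μ (k + k') l = cPair n d μ k l + cPair n d μ k' l := by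
  simp only [cPair, ← Finset.sum_add_distrib]
  refine Finset.sum_congr rfl fun i _ => Finset.sum_congr rfl fun j _ => ?_
  split_ifs <;> simp [add_mul]

theorem cPair_add_right (k l l' : Fin n → ZMod d) :
    cPair n d μ k (l + l') = cPair n d μ k l + cPair n d μ k l' := by
  simp only [cPair, ← Finset.sum_add_distrib]
  refine Finset.sum_congr rfl fun i _ => Finset.sum_congr rfl fun j _ => ?_
  split_ifs <;> simp [mul_add]

@[simp]
theorem cPair_zero_left (l : Fin n → ZMod d) : cPair n d μ 0 l = 0 := by
  simp [cPair]

@[simp]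
theorem cPair_zero_right (k : Fin n → ZMod d) : cPair n d μ k 0 = 0 := by
  simp [cPair]

end cPair

section rhoF

variable {n d : ℕ} (μ : Fin n → Fin n → ZMod d)

theorem rhoF_bijective (g : ZMod d × (Fin n → ZMod d)) :
    Function.Bijective (rhoF n d μ g) := by
  constructor
  · intro f f' h
    funext l
    have hl := congrFun h (l + g.2)
    simp only [rhoF, add_sub_cancel_right] at hl
    exact mul_left_cancel₀ (omegad_pow_ne_zero _ _) hl
  · intro f
    refine ⟨fun l => (omegad d ^ (g.1 + cPair n d μ g.2 l).val)⁻¹ * f (l + g.2), ?_⟩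
    funext m
    simp only [rhoF, sub_add_cancel]
    exact mul_inv_cancel_left₀ (omegad_pow_ne_zero _ _) _

theorem sum_conj_rhoF_mul_rhoF [NeZero d] (g : ZMod d × (Fin n → ZMod d))
    (f f' : (Fin n → ZMod d) → ℂ) :
    ∑ m : Fin n → ZMod d, conj (rhoF n d μ g f m) * rhoF n d μ g f' m =
      ∑ m : Fin n → ZMod d, conj (f m) * f' m := by
  rw [← Equiv.sum_comp (Equiv.subRight g.2) fun m => conj (f m) * f' m]
  refine Finset.sum_congr rfl fun m _ => ?_
  rw [rhoF, rhoF, map_mul, mul_mul_mul_comm, conj_omegad_pow_mul_self, one_mul]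
  rfl

theorem rhoF_Hmul [NeZero d] (g h : ZMod d × (Fin n → ZMod d)) :
    rhoF n d μ (Hmul n d μ g h) = rhoF n d μ g ∘ rhoF n d μ h := by
  funext f m
  have hsub : m - (g.2 + h.2) = m - g.2 - h.2 := sub_add_eq_sub_sub _ _ _
  have hpair : cPair n d μ g.2 (m - g.2) =
      cPair n d μ g.2 h.2 + cPair n d μ g.2 (m - g.2 - h.2) := by
    rw [← cPair_add_right, add_sub_cancel]
  simp only [rhoF, Hmul, Function.comp_apply]
  rw [hsub, ← mul_assoc, ← omegad_pow_val_add, hpair, cPair_add_left]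
  congr 3
  ring

theorem rhoF_injective [NeZero d] : Function.Injective (rhoF n d μ) := by
  intro g h hgh
  have key := congrFun (congrFun hgh (Pi.single 0 1)) g.2
  simp only [rhoF, sub_self, Pi.single_eq_same, cPair_zero_right, add_zero, mul_one] at key
  have h2 : g.2 = h.2 := by
    by_contra hne
    rw [Pi.single_eq_of_ne (sub_ne_zero.mpr hne), mul_zero] at key
    exact omegad_pow_ne_zero _ _ key
  rw [h2, sub_self, Pi.single_eq_same, cPair_zero_right, add_zero, mul_one] at key
  exact Prod.ext (omegad_pow_val_injective d key) h2

theorem rhoF_scalar (k : ZMod d) :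
    rhoF n d μ (k, 0) = fun f => (omegad d ^ k.val) • f := by
  funext f m
  simp [rhoF]

end rhoF

theorem stmt18 (n d : ℕ) [NeZero d] (hd : 2 ≤ d) (μ : Fin n → Fin n → ZMod d)
    (hskew : ∀ i j, μ i j = - μ j i) (hdiag : ∀ i, μ i i = 0) :
    -- each ρ(k, k⃗) is a (well-defined) unitary operator on ℋ:
    -- it is linear, bijective, and preserves the inner product
    (∀ g : ZMod d × (Fin n → ZMod d),
      (∀ f f' : (Fin n → ZMod d) → ℂ, rhoF n d μ g (f + f') = rhoF n d μ g f + rhoF n d μ g f') ∧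
      (∀ (a : ℂ) (f : (Fin n → ZMod d) → ℂ), rhoF n d μ g (a • f) = a • rhoF n d μ g f) ∧
      Function.Bijective (rhoF n d μ g) ∧
      (∀ f f' : (Fin n → ZMod d) → ℂ,
        ∑ m : Fin n → ZMod d, conj (rhoF n d μ g f m) * rhoF n d μ g f' m =
          ∑ m : Fin n → ZMod d, conj (f m) * f' m)) ∧
    -- ρ is a group homomorphism
    (∀ g h : ZMod d × (Fin n → ZMod d),
      rhoF n d μ (Hmul n d μ g h) = rhoF n d μ g ∘ rhoF n d μ h) ∧
    -- ρ is injective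
    Function.Injective (rhoF n d μ) ∧
    -- ρ preserves scalars: ρ(k, 0⃗) = ω^k · id
    (∀ k : ZMod d, rhoF n d μ (k, 0) = fun f => (omegad d ^ k.val) • f) := by
  refine ⟨fun g => ⟨fun f f' => ?_, fun a f => ?_, rhoF_bijective μ g,
    sum_conj_rhoF_mul_rhoF μ g⟩, rhoF_Hmul μ, rhoF_injective μ, rhoF_scalar μ⟩
  · funext m
    exact mul_add _ _ _
  · funext m
    exact mul_left_comm _ _ _
end
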